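/- arXiv:2110.02819 — 2 statements merged into one kernel-verified Lean document; each statement's English description precedes it below -/
import Mathlib

section
/- Let T > 0, α > 0 and L > 0, and suppose f : [0,T] × ℝ^d → ℝ^d and g : [0,T] × ℝ^d → ℝ^{d×m} satisfy |f(t,x) − f(t,y)| ∨ |g(t,x) − g(t,y)| ≤ L(1 + |x|^α + |y|^α)|x − y| for all t ∈ [0,T] and all x, y ∈ ℝ^d. Then for every R > 0, every t ∈ [0,T] and all x, y ∈ ℝ^d, |f(t, π_R(x)) − f(t, π_R(y))| ∨ |g(t, π_R(x)) − g(t, π_R(y))| ≤ L(1 + |x|^α + |y|^α)|x − y|. -/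
/-- The truncation mapping `π_R(x) = (min(|x|, R)/|x|) • x` (with `π_R 0 = 0`). -/
noncomputable def truncMap {d : ℕ} (R : ℝ) (x : EuclideanSpace ℝ (Fin d)) :
    EuclideanSpace ℝ (Fin d) :=
  (min ‖x‖ R / ‖x‖) • x

theorem truncMap_decomp {d : ℕ} (R : ℝ) (hR : 0 < R) (x : EuclideanSpace ℝ (Fin d)) :
    ∃ c : ℝ, 0 ≤ c ∧ x = truncMap R x + c • truncMap R x ∧ ‖truncMap R x‖ ≤ R ∧
      ‖truncMap R x‖ ≤ ‖x‖ ∧ (c = 0 ∨ ‖truncMap R x‖ = R) := by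
  by_cases h : ‖x‖ ≤ R
  · have hx : truncMap R x = x := by
      unfold truncMap
      rw [min_eq_left h]
      by_cases h0 : x = 0
      · simp [h0]
      · rw [div_self (norm_ne_zero_iff.mpr h0), one_smul]
    refine ⟨0, le_rfl, ?_, ?_, ?_, Or.inl rfl⟩
    · simp [hx]
    · rw [hx]; exact h
    · rw [hx]
  · have h := not_le.mp h
    have hp : 0 < ‖x‖ := hR.trans h
    have hx : truncMap R x = (R / ‖x‖) • x := by
      unfold truncMap
      rw [min_eq_right h.le]
    have hn : ‖truncMap R x‖ = R := by
      rw [hx, norm_smul, Real.norm_eq_abs, abs_of_pos (div_pos hR hp)]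
      field_simp
    refine ⟨‖x‖ / R - 1, ?_, ?_, hn.le, hn.le.trans h.le, Or.inr hn⟩
    · rw [sub_nonneg, le_div_iff₀ hR]; linarith
    · rw [hx, smul_smul, ← add_smul]
      have : R / ‖x‖ + (‖x‖ / R - 1) * (R / ‖x‖) = 1 := by field_simp; ring
      rw [this, one_smul]

theorem truncMap_nonexp {d : ℕ} (R : ℝ) (hR : 0 < R) (x y : EuclideanSpace ℝ (Fin d)) :
    ‖truncMap R x - truncMap R y‖ ≤ ‖x - y‖ := by
  obtain ⟨c, hc, hx, hxR, -, hcR⟩ := truncMap_decomp R hR x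
  obtain ⟨e, he, hy, hyR, -, heR⟩ := truncMap_decomp R hR y
  generalize truncMap R x = u at *
  generalize truncMap R y = v at *
  have key : ∀ (c : ℝ) (u v : EuclideanSpace ℝ (Fin d)), 0 ≤ c → ‖v‖ ≤ R →
      (c = 0 ∨ ‖u‖ = R) → 0 ≤ c * inner ℝ u (u - v) := by
    intro c u v hc hv h
    rcases h with h | h
    · simp [h]
    · apply mul_nonneg hc
      rw [inner_sub_right, real_inner_self_eq_norm_sq, h]
      have := real_inner_le_norm u v
      rw [h] at this
      nlinarith
  have h1 := key c u v hc hyR hcR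
  have h2 := key e v u he hxR heR
  have h3 : inner ℝ (x - y) (u - v) =
      ‖u - v‖ ^ 2 + c * inner ℝ u (u - v) + e * inner ℝ v (v - u) := by
    rw [← real_inner_self_eq_norm_sq, hx, hy]
    simp only [inner_sub_left, inner_sub_right, inner_add_left, real_inner_smul_left]
    ring
  have h4 := real_inner_le_norm (x - y) (u - v)
  by_contra hlt
  have hlt := not_le.mp hlt
  nlinarith [norm_nonneg (x - y), norm_nonneg (u - v)]

/-- the truncated coefficients inherit the polynomially-weighted
Lipschitz condition. -/
theorem stmt_3 (T α L : ℝ) (hT : 0 < T) (hα : 0 < α) (hL : 0 < L) (d m : ℕ)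
    (f : ℝ → EuclideanSpace ℝ (Fin d) → EuclideanSpace ℝ (Fin d))
    (g : ℝ → EuclideanSpace ℝ (Fin d) → EuclideanSpace ℝ (Fin d × Fin m))
    (hLip : ∀ t ∈ Set.Icc (0 : ℝ) T, ∀ x y : EuclideanSpace ℝ (Fin d),
      max ‖f t x - f t y‖ ‖g t x - g t y‖ ≤ L * (1 + ‖x‖ ^ α + ‖y‖ ^ α) * ‖x - y‖) :
    ∀ R : ℝ, 0 < R → ∀ t ∈ Set.Icc (0 : ℝ) T, ∀ x y : EuclideanSpace ℝ (Fin d),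
      max ‖f t (truncMap R x) - f t (truncMap R y)‖ ‖g t (truncMap R x) - g t (truncMap R y)‖ ≤
        L * (1 + ‖x‖ ^ α + ‖y‖ ^ α) * ‖x - y‖ := by
  intro R hR t ht x y
  obtain ⟨-, -, -, -, hx, -⟩ := truncMap_decomp R hR x
  obtain ⟨-, -, -, -, hy, -⟩ := truncMap_decomp R hR y
  have hn := truncMap_nonexp R hR x y
  refine (hLip t ht _ _).trans ?_
  gcongr
end

section
/- Define f(t,x) = (t(1−t))^{1/2}·x² − 2x⁵ and g(t,x) = (t(1−t))^{1/4}·x² for t ∈ [0,1] and x ∈ ℝ. Then for every p > 1 there exists a constant C > 0 such that for all t ∈ [0,1] and all x, y ∈ ℝ, (x − y)(f(t,x) − f(t,y)) + ((5p − 1)/2)(g(t,x) − g(t,y))² ≤ C(x − y)². -/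
/-- the coefficients of Example 4.1 satisfy the one-sided Lipschitz
(monotonicity-type) condition. -/
theorem stmt_8
    (f : ℝ → ℝ → ℝ) (hf : ∀ t x, f t x = (t * (1 - t)) ^ ((1 : ℝ) / 2) * x ^ 2 - 2 * x ^ 5)
    (g : ℝ → ℝ → ℝ) (hg : ∀ t x, g t x = (t * (1 - t)) ^ ((1 : ℝ) / 4) * x ^ 2) :
    ∀ p : ℝ, 1 < p → ∃ C : ℝ, 0 < C ∧ ∀ t ∈ Set.Icc (0 : ℝ) 1, ∀ x y : ℝ,
      (x - y) * (f t x - f t y) + ((5 * p - 1) / 2) * (g t x - g t y) ^ 2 ≤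
        C * (x - y) ^ 2 := by
  intro p hp
  obtain ⟨K, hK⟩ : ∃ K, K = (5 * p - 1) / 2 := ⟨_, rfl⟩
  have hK0 : 0 < K := by rw [hK]; linarith
  refine ⟨1 + (K + 1) ^ 2 / 2, by positivity, ?_⟩
  rintro t ⟨h0, h1⟩ x y
  rw [hf, hf, hg, hg, ← hK]
  have hw0 : 0 ≤ t * (1 - t) := mul_nonneg h0 (by linarith)
  have hw1 : t * (1 - t) ≤ 1 := by nlinarith
  have hab : ((t * (1 - t)) ^ ((1 : ℝ) / 4)) ^ 2 = (t * (1 - t)) ^ ((1 : ℝ) / 2) := by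
    rw [← Real.rpow_natCast, ← Real.rpow_mul hw0]
    norm_num
  have ha0 : 0 ≤ (t * (1 - t)) ^ ((1 : ℝ) / 2) := Real.rpow_nonneg hw0 _
  have ha1 : (t * (1 - t)) ^ ((1 : ℝ) / 2) ≤ 1 := Real.rpow_le_one hw0 hw1 (by norm_num)
  generalize (t * (1 - t)) ^ ((1 : ℝ) / 2) = a at *
  generalize (t * (1 - t)) ^ ((1 : ℝ) / 4) = b at *
  have key : a * (x + y) + K * a * (x + y) ^ 2
      - 2 * (x ^ 4 + x ^ 3 * y + x ^ 2 * y ^ 2 + x * y ^ 3 + y ^ 4) ≤ 1 + (K + 1) ^ 2 / 2 := by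
    have hQ : 2 * (x ^ 4 + x ^ 3 * y + x ^ 2 * y ^ 2 + x * y ^ 3 + y ^ 4)
        = (5 * (x + y) ^ 4 + 10 * ((x + y) * (x - y)) ^ 2 + (x - y) ^ 4) / 8 := by ring
    rw [hQ]
    have e1 : 0 ≤ (x - y) ^ 4 := by positivity
    have e2 : 0 ≤ ((x + y) * (x - y)) ^ 2 := by positivity
    generalize x + y = s at *
    have e3 : a * s ≤ a * (1 + s ^ 2) := mul_le_mul_of_nonneg_left (by nlinarith [sq_nonneg (s - 1)]) ha0
    have e4 : a * (1 + s ^ 2) ≤ 1 * (1 + s ^ 2) := mul_le_mul_of_nonneg_right ha1 (by positivity)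
    have e5 : a * (K * s ^ 2) ≤ 1 * (K * s ^ 2) := mul_le_mul_of_nonneg_right ha1 (by positivity)
    have e6 : 0 ≤ s ^ 4 := by positivity
    nlinarith [sq_nonneg (s ^ 2 - (K + 1))]
  calc _ = (a * (x + y) + K * b ^ 2 * (x + y) ^ 2
      - 2 * (x ^ 4 + x ^ 3 * y + x ^ 2 * y ^ 2 + x * y ^ 3 + y ^ 4)) * (x - y) ^ 2 := by ring
    _ ≤ _ := by
      rw [hab]
      exact mul_le_mul_of_nonneg_right key (sq_nonneg _)
end
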